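/- Suppose Assumptions 1 and 2 hold. Fix γ > 0, ν > 0, δ := 2ν + L_{∇h} + 2‖A‖²/γ, β ∈ (0,2), and set c₁ := ν, c₂ := δ(2−β)/(2β), c₃ := γ/2. Let x^k ∈ S, u^k ∈ ℝⁿ, z^k := prox_{g*,1/γ}(Ax^k/γ), and θ_k > 0 with θ_k f(Kx^k) = Ψ(x^k,z^k,u^k;δ,γ). Define y^{k+1} ∈ ∂f(Kx^k), x^{k+1} := the unique minimizer over S of x ↦ ⟨z^k, Ax⟩ − θ_k⟨Kx, y^{k+1}⟩ + ⟨∇h(x^k), x − x^k⟩ + (δ/2)‖x − u^k‖², u^{k+1} := (1−β)u^k + βx^{k+1}, and z^{k+1} := prox_{g*,1/γ}(Ax^{k+1}/γ). Then Ψ(x^{k+1},z^{k+1},u^{k+1};δ,γ) − θ_k f(Kx^{k+1}) ≤ −c₁‖x^k − x^{k+1}‖² − c₂‖u^k − u^{k+1}‖² − c₃‖z^k − z^{k+1}‖². -/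

import Mathlib

open Set Filter Topology Metric

open scoped RealInnerProductSpace

noncomputable section

namespace FracPaper

variable {E : Type*} [NormedAddCommGroup E] [InnerProductSpace ℝ E] [FiniteDimensional ℝ E]
variable {F : Type*} [NormedAddCommGroup F] [InnerProductSpace ℝ F] [FiniteDimensional ℝ F]
variable {G : Type*} [NormedAddCommGroup G] [InnerProductSpace ℝ G] [FiniteDimensional ℝ G]

/-- The effective domain of an `EReal`-valued function. -/
def edom (f : E → EReal) : Set E := {x | f x ≠ ⊤}

/-- `f` is proper: it takes values in `ℝ ∪ {+∞}` and is not identically `+∞`. -/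
def ProperFn (f : E → EReal) : Prop := (∀ x, f x ≠ ⊥) ∧ ∃ x, f x ≠ ⊤

/-- Convexity for `EReal`-valued functions. -/
def ConvexFn (f : E → EReal) : Prop :=
  ∀ x y : E, ∀ a b : ℝ, 0 ≤ a → 0 ≤ b → a + b = 1 →
    f (a • x + b • y) ≤ (a : EReal) * f x + (b : EReal) * f y

/-- The Fenchel conjugate of an `EReal`-valued function. -/
def conj (f : E → EReal) : E → EReal :=
  fun v => ⨆ x : E, ((⟪v, x⟫ : EReal) - f x)

/-- The `ε`-subdifferential (for convex functions). -/
def epsSubdiff (f : E → EReal) (ε : ℝ) (w : E) : Set E :=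
  {v | f w ≠ ⊤ ∧ ∀ y : E, f w + ((⟪v, y - w⟫ - ε : ℝ) : EReal) ≤ f y}

/-- The convex subdifferential. -/
def subdiff (f : E → EReal) (w : E) : Set E := epsSubdiff f 0 w

/-- The Fréchet subdifferential. -/
def frechetSubdiff (f : E → EReal) (w : E) : Set E :=
  {v | f w ≠ ⊤ ∧ ∀ ε : ℝ, 0 < ε →
    ∀ᶠ y in nhds w, f w + ((⟪v, y - w⟫ - ε * ‖y - w‖ : ℝ) : EReal) ≤ f y}

/-- The limiting (Mordukhovich) subdifferential. -/
def limitingSubdiff (f : E → EReal) (w : E) : Set E :=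
  {v | ∃ xs vs : ℕ → E,
      Tendsto xs atTop (nhds w) ∧
      Tendsto (fun k => f (xs k)) atTop (nhds (f w)) ∧
      Tendsto vs atTop (nhds v) ∧
      ∀ k, vs k ∈ frechetSubdiff f (xs k)}

open Classical in
/-- The indicator function of a set, with values in `EReal`. -/
def indicatorFn (S : Set E) : E → EReal := fun x => if x ∈ S then (0 : EReal) else ⊤

/-- Calmness of an `EReal`-valued function at a point. -/
def CalmAt (f : E → EReal) (x : E) : Prop :=
  ∃ ε κ : ℝ, 0 < ε ∧ 0 < κ ∧ ∀ y ∈ ball x ε,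
    f y ≤ f x + ((κ * ‖y - x‖ : ℝ) : EReal) ∧ f x ≤ f y + ((κ * ‖y - x‖ : ℝ) : EReal)

/-- Essential strict convexity: strict convexity on every convex subset of `dom ∂g`. -/
def EssStrictConvexFn (g : F → EReal) : Prop :=
  ∀ C : Set F, Convex ℝ C → (∀ w ∈ C, (subdiff g w).Nonempty) →
    ∀ x ∈ C, ∀ y ∈ C, x ≠ y → ∀ a b : ℝ, 0 < a → 0 < b → a + b = 1 →
      g (a • x + b • y) < (a : EReal) * g x + (b : EReal) * g y

/-- The Kurdyka–Łojasiewicz property at a point. -/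
def KLAt (f : E → EReal) (xh : E) : Prop :=
  ∃ μ : ℝ, 0 < μ ∧ ∃ U ∈ nhds xh, ∃ φ φd : ℝ → ℝ,
    ContinuousOn φ (Ico 0 μ) ∧ ConcaveOn ℝ (Ico 0 μ) φ ∧ φ 0 = 0 ∧
    (∀ t ∈ Ioo 0 μ, HasDerivAt φ (φd t) t ∧ 0 < φd t) ∧
    ∀ x ∈ U, f xh < f x → f x < f xh + (μ : EReal) →
      ∀ v ∈ limitingSubdiff f x, 1 ≤ φd ((f x).toReal - (f xh).toReal) * ‖v‖

/-- The augmented function `Ψ`. -/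
def psi (S : Set E) (g : F → EReal) (h : E → ℝ) (A : E →L[ℝ] F) (δ γ : ℝ)
    (x : E) (z : F) (u : E) : EReal :=
  ((⟪z, A x⟫ + h x + δ / 2 * ‖x - u‖ ^ 2 - γ / 2 * ‖z‖ ^ 2 : ℝ) : EReal)
    - conj g z + indicatorFn S x

/-- Assumption 1 of the paper. `h'` is the gradient of `h` and `Lh` its Lipschitz constant. -/
def Assumption1 (S : Set E) (g : F → EReal) (h : E → ℝ) (h' : E → E) (Lh : ℝ)
    (f : G → EReal) (A : E →L[ℝ] F) (K : E →L[ℝ] G) : Prop :=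
  S.Nonempty ∧ Convex ℝ S ∧ IsCompact S ∧
  ProperFn g ∧ ConvexFn g ∧ LowerSemicontinuous g ∧
  (∃ O : Set E, IsOpen O ∧ S ⊆ O ∧ (∀ x ∈ O, HasGradientAt h (h' x) x) ∧
      ∀ x ∈ O, ∀ y ∈ O, ‖h' x - h' y‖ ≤ Lh * ‖x - y‖) ∧
  ProperFn f ∧ ConvexFn f ∧ LowerSemicontinuous f ∧
  (∀ x ∈ S, K x ∈ interior (edom f)) ∧ (∀ x ∈ S, 0 < f (K x)) ∧
  (∃ x ∈ S, A x ∈ edom g) ∧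
  (∃ α : ℝ, 0 < α ∧ ∀ x ∈ S, (α : EReal) ≤ g (A x) + (h x : EReal))

/-- Assumption 2 of the paper. -/
def Assumption2 (S : Set E) (g : F → EReal) (A : E →L[ℝ] F) : Prop :=
  (∀ x ∈ S, (subdiff g (A x)).Nonempty) ∧
  ∃ ℓ : ℝ, 0 < ℓ ∧ ∀ x ∈ S, infDist 0 (subdiff g (A x)) ≤ ℓ

/-- The constant-parameter algorithm (FSPS with fixed `γ`, `δ`, `β`). -/
def IsAlgoSeq (S : Set E) (g : F → EReal) (h : E → ℝ) (h' : E → E) (f : G → EReal)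
    (A : E →L[ℝ] F) (K : E →L[ℝ] G) (γ δ β : ℝ)
    (x u : ℕ → E) (y : ℕ → G) (z : ℕ → F) (θ : ℕ → ℝ) : Prop :=
  x 0 ∈ S ∧
  (∀ k, ∀ ζ : F, conj g (z k) + ((-⟪z k, A (x k)⟫ + γ / 2 * ‖z k‖ ^ 2 : ℝ) : EReal)
      ≤ conj g ζ + ((-⟪ζ, A (x k)⟫ + γ / 2 * ‖ζ‖ ^ 2 : ℝ) : EReal)) ∧
  (∀ k, 0 < θ k ∧ ((θ k : ℝ) : EReal) * f (K (x k)) = psi S g h A δ γ (x k) (z k) (u k)) ∧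
  (∀ k, y (k + 1) ∈ subdiff f (K (x k))) ∧
  (∀ k, x (k + 1) ∈ S ∧ ∀ w ∈ S,
      ⟪z k, A (x (k + 1))⟫ - θ k * ⟪K (x (k + 1)), y (k + 1)⟫
          + ⟪h' (x k), x (k + 1)⟫ + δ / 2 * ‖x (k + 1) - u k‖ ^ 2
        ≤ ⟪z k, A w⟫ - θ k * ⟪K w, y (k + 1)⟫ + ⟪h' (x k), w⟫
          + δ / 2 * ‖w - u k‖ ^ 2) ∧
  (∀ k, u (k + 1) = (1 - β) • u k + β • x (k + 1))

/-- `x̄` is a limiting `(ε₁, ε₂)`-lifted stationary point of the fractional program. -/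
def IsLiftedStat (S : Set E) (g : F → EReal) (h : E → ℝ) (h' : E → E) (f : G → EReal)
    (A : E →L[ℝ] F) (K : E →L[ℝ] G) (ε₁ ε₂ : ℝ) (xb : E) : Prop :=
  ∃ Ψb : ℝ, |Ψb - ((g (A xb)).toReal + h xb)| ≤ ε₂ ∧
    ∃ v ∈ epsSubdiff g ε₁ (A xb), ∃ w ∈ subdiff (indicatorFn S) xb,
      ∃ s ∈ subdiff f (K xb),
        (f (K xb)).toReal • (ContinuousLinearMap.adjoint A v + h' xb + w)
          - Ψb • (ContinuousLinearMap.adjoint K s) = 0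


lemma nonneg_of_forall_add_mul_nonneg {X Y : ℝ} (H : ∀ t ∈ Ioo (0 : ℝ) 1, 0 ≤ X + t * Y) :
    0 ≤ X := by
  have hlim : Tendsto (fun t : ℝ => X + t * Y) (𝓝[>] 0) (𝓝 X) := by
    have hc : Continuous fun t : ℝ => X + t * Y := by fun_prop
    simpa using (hc.tendsto 0).mono_left nhdsWithin_le_nhds
  exact ge_of_tendsto hlim
    (Filter.eventually_of_mem (Ioo_mem_nhdsGT one_pos) H)

/-- The descent lemma on a segment along which the gradient is Lipschitz. -/
lemma descent_of_gradient_lipschitz {V : Type*} [NormedAddCommGroup V] [InnerProductSpace ℝ V]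
    [CompleteSpace V] {O : Set V} {h : V → ℝ} {h' : V → V} {L : ℝ}
    (hgrad : ∀ x ∈ O, HasGradientAt h (h' x) x)
    (hlip : ∀ x ∈ O, ∀ y ∈ O, ‖h' x - h' y‖ ≤ L * ‖x - y‖)
    {x y : V} (hseg : segment ℝ x y ⊆ O) :
    h y ≤ h x + ⟪h' x, y - x⟫ + L / 2 * ‖y - x‖ ^ 2 := by
  have hmem : ∀ t ∈ Icc (0 : ℝ) 1, x + t • (y - x) ∈ O := fun t ht =>
    hseg (by rw [segment_eq_image']; exact ⟨t, ht, rfl⟩)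
  have hder : ∀ t ∈ Icc (0 : ℝ) 1,
      HasDerivAt (fun t : ℝ => h (x + t • (y - x)) - t * ⟪h' x, y - x⟫
        - t ^ 2 * (L / 2 * ‖y - x‖ ^ 2))
        (⟪h' (x + t • (y - x)), y - x⟫ - ⟪h' x, y - x⟫ - 2 * t * (L / 2 * ‖y - x‖ ^ 2)) t := by
    intro t ht
    have hline : HasDerivAt (fun t : ℝ => x + t • (y - x)) (y - x) t := by
      simpa using ((hasDerivAt_id t).smul_const (y - x)).const_add x
    have hcomp := (hgrad _ (hmem t ht)).hasFDerivAt.comp_hasDerivAt t hline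
    have hlin := (hasDerivAt_id t).mul_const ⟪h' x, y - x⟫
    have hquad := ((hasDerivAt_id t).pow 2).mul_const (L / 2 * ‖y - x‖ ^ 2)
    refine ((hcomp.sub hlin).sub hquad).congr_deriv ?_
    simp
  have hanti := antitoneOn_of_hasDerivWithinAt_nonpos (convex_Icc (0 : ℝ) 1)
    (fun t ht => (hder t ht).continuousAt.continuousWithinAt)
    (fun t ht => (hder t (interior_subset ht)).hasDerivWithinAt) (fun t ht => by
      have ht' := interior_subset ht
      have h1 := hlip _ (hmem t ht') x (hseg (left_mem_segment ℝ x y))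
      rw [add_sub_cancel_left, norm_smul, Real.norm_of_nonneg ht'.1] at h1
      have h2 := real_inner_le_norm (h' (x + t • (y - x)) - h' x) (y - x)
      rw [inner_sub_left] at h2
      nlinarith [mul_le_mul_of_nonneg_right h1 (norm_nonneg (y - x))])
  have := hanti (left_mem_Icc.2 zero_le_one) (right_mem_Icc.2 zero_le_one) zero_le_one
  simp at this
  linarith

/-- Quadratic growth at a minimizer of a linear functional plus `δ / 2 * ‖· - u‖ ^ 2` over a convex set. -/
lemma quadratic_growth_of_linear_add_sq {V : Type*} [NormedAddCommGroup V] [InnerProductSpace ℝ V]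
    {S : Set V} (hS : Convex ℝ S) {p u x : V} {δ : ℝ}
    (hx : x ∈ S)
    (hmin : ∀ w ∈ S, ⟪p, x⟫ + δ / 2 * ‖x - u‖ ^ 2 ≤ ⟪p, w⟫ + δ / 2 * ‖w - u‖ ^ 2)
    {w : V} (hw : w ∈ S) :
    ⟪p, x⟫ + δ / 2 * ‖x - u‖ ^ 2 + δ / 2 * ‖w - x‖ ^ 2 ≤ ⟪p, w⟫ + δ / 2 * ‖w - u‖ ^ 2 := by
  have key : 0 ≤ ⟪p, w - x⟫ + δ * ⟪x - u, w - x⟫ := by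
    refine nonneg_of_forall_add_mul_nonneg (Y := δ / 2 * ‖w - x‖ ^ 2) fun t ht => ?_
    have h1 := hmin _ (hS.add_smul_sub_mem hx hw ⟨ht.1.le, ht.2.le⟩)
    have e : x + t • (w - x) - u = (x - u) + t • (w - x) := by abel
    rw [e, norm_add_sq_real, inner_add_right, inner_smul_right, inner_smul_right, norm_smul,
      Real.norm_of_nonneg ht.1.le] at h1
    refine le_of_mul_le_mul_left ?_ ht.1
    linarith
  have e : w - u = (x - u) + (w - x) := by abel
  rw [e, norm_add_sq_real]
  rw [inner_sub_right p] at key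
  linarith

lemma conj_ne_bot {V : Type*} [NormedAddCommGroup V] [InnerProductSpace ℝ V]
    {g : V → EReal} (hg : ProperFn g) (v : V) : conj g v ≠ ⊥ := by
  obtain ⟨x, hx⟩ := hg.2
  have h1 : ((⟪v, x⟫ : ℝ) : EReal) - g x ≤ conj g v := le_iSup (fun x => (⟪v, x⟫ : EReal) - g x) x
  lift g x to ℝ using ⟨hx, hg.1 x⟩ with a
  intro h
  rw [h, le_bot_iff] at h1
  exact EReal.coe_ne_bot _ (by exact_mod_cast h1)

lemma conj_ne_top_of_mem_subdiff {V : Type*} [NormedAddCommGroup V] [InnerProductSpace ℝ V]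
    {g : V → EReal} (hg : ProperFn g) {w v : V}
    (hv : v ∈ subdiff g w) : conj g v ≠ ⊤ := by
  obtain ⟨hw, hsub⟩ := hv
  lift g w to ℝ using ⟨hw, hg.1 w⟩ with a
  refine ne_top_of_le_ne_top (EReal.coe_ne_top (⟪v, w⟫ - a)) (iSup_le fun x => ?_)
  have h1 := hsub x
  have hb := hg.1 x
  generalize g x = r at h1 hb ⊢
  induction r with
  | bot => exact absurd rfl hb
  | top => simp
  | coe b =>
    have h2 : a + (⟪v, x - w⟫ - 0) ≤ b := by exact_mod_cast h1
    rw [inner_sub_right] at h2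
    have h3 : ⟪v, x⟫ - b ≤ ⟪v, w⟫ - a := by linarith
    exact_mod_cast h3

lemma conj_le_of_convex_combination {V : Type*} [NormedAddCommGroup V] [InnerProductSpace ℝ V]
    {g : V → EReal} (hg : ProperFn g) {z ζ : V} {a c t : ℝ}
    (ha : conj g z = a) (hc : conj g ζ = c) (ht : t ∈ Icc (0 : ℝ) 1) :
    conj g (z + t • (ζ - z)) ≤ ((a + t * (c - a) : ℝ) : EReal) := by
  refine iSup_le fun x => ?_
  have h1 : ((⟪z, x⟫ : ℝ) : EReal) - g x ≤ a := ha ▸ le_iSup (fun x => (⟪z, x⟫ : EReal) - g x) x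
  have h2 : ((⟪ζ, x⟫ : ℝ) : EReal) - g x ≤ c := hc ▸ le_iSup (fun x => (⟪ζ, x⟫ : EReal) - g x) x
  have hb := hg.1 x
  generalize g x = r at h1 h2 hb ⊢
  induction r with
  | bot => exact absurd rfl hb
  | top => simp
  | coe b =>
    have h1 : ⟪z, x⟫ - b ≤ a := by exact_mod_cast h1
    have h2 : ⟪ζ, x⟫ - b ≤ c := by exact_mod_cast h2
    have h3 : ⟪z + t • (ζ - z), x⟫ - b ≤ a + t * (c - a) := by
      rw [inner_add_left, real_inner_smul_left, inner_sub_left]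
      nlinarith [ht.1, ht.2]
    exact_mod_cast h3

lemma conj_ne_top_of_prox {V : Type*} [NormedAddCommGroup V] [InnerProductSpace ℝ V]
    {g : V → EReal} (hg : ProperFn g) {p z v : V} {γ : ℝ}
    (hv : conj g v ≠ ⊤)
    (hz : ∀ ζ : V, conj g z + ((-⟪z, p⟫ + γ / 2 * ‖z‖ ^ 2 : ℝ) : EReal)
        ≤ conj g ζ + ((-⟪ζ, p⟫ + γ / 2 * ‖ζ‖ ^ 2 : ℝ) : EReal)) : conj g z ≠ ⊤ := by
  intro h
  have h1 := hz v
  lift conj g v to ℝ using ⟨hv, conj_ne_bot hg v⟩ with c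
  rw [h, EReal.top_add_coe, top_le_iff] at h1
  exact EReal.coe_ne_top _ (by exact_mod_cast h1)

/-- Quadratic growth of the proximal objective of the conjugate at its minimizer. -/
lemma quadratic_growth_of_prox_conj {V : Type*} [NormedAddCommGroup V] [InnerProductSpace ℝ V]
    {g : V → EReal} (hg : ProperFn g) {p z ζ : V} {γ a c : ℝ}
    (ha : conj g z = a) (hc : conj g ζ = c)
    (hz : ∀ ζ : V, conj g z + ((-⟪z, p⟫ + γ / 2 * ‖z‖ ^ 2 : ℝ) : EReal)
        ≤ conj g ζ + ((-⟪ζ, p⟫ + γ / 2 * ‖ζ‖ ^ 2 : ℝ) : EReal)) :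
    a - ⟪z, p⟫ + γ / 2 * ‖z‖ ^ 2 + γ / 2 * ‖ζ - z‖ ^ 2 ≤ c - ⟪ζ, p⟫ + γ / 2 * ‖ζ‖ ^ 2 := by
  have key : 0 ≤ c - a - ⟪ζ - z, p⟫ + γ * ⟪z, ζ - z⟫ := by
    refine nonneg_of_forall_add_mul_nonneg (Y := γ / 2 * ‖ζ - z‖ ^ 2) fun t ht => ?_
    have h1 := (hz (z + t • (ζ - z))).trans (add_le_add_left
      (conj_le_of_convex_combination hg ha hc ⟨ht.1.le, ht.2.le⟩) _)
    rw [ha] at h1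
    have h2 : a + (-⟪z, p⟫ + γ / 2 * ‖z‖ ^ 2) ≤ a + t * (c - a) +
        (-⟪z + t • (ζ - z), p⟫ + γ / 2 * ‖z + t • (ζ - z)‖ ^ 2) := by exact_mod_cast h1
    rw [norm_add_sq_real, inner_add_left, real_inner_smul_left, inner_smul_right, norm_smul,
      Real.norm_of_nonneg ht.1.le] at h2
    refine le_of_mul_le_mul_left ?_ ht.1
    linarith
  have e : ζ = z + (ζ - z) := by abel
  have e2 : ‖ζ‖ ^ 2 = ‖z‖ ^ 2 + 2 * ⟪z, ζ - z⟫ + ‖ζ - z‖ ^ 2 := by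
    rw [← norm_add_sq_real, ← e]
  rw [e2]
  rw [inner_sub_left] at key
  linarith

/-- one-step descent estimate (Theorem 5.3 (ii)). -/
theorem one_step_descent_theta
    (S : Set E) (g : F → EReal) (h : E → ℝ) (h' : E → E) (Lh : ℝ)
    (f : G → EReal) (A : E →L[ℝ] F) (K : E →L[ℝ] G)
    (hA1 : Assumption1 S g h h' Lh f A K) (hA2 : Assumption2 S g A)
    (γ ν β δ c₁ c₂ c₃ : ℝ) (hγ : 0 < γ) (hν : 0 < ν) (hβ : β ∈ Ioo (0 : ℝ) 2)
    (hδ : δ = 2 * ν + Lh + 2 * ‖A‖ ^ 2 / γ)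
    (hc₁ : c₁ = ν) (hc₂ : c₂ = δ * (2 - β) / (2 * β)) (hc₃ : c₃ = γ / 2)
    (xk uk : E) (θk : ℝ) (zk : F) (yk1 : G) (xk1 uk1 : E) (zk1 : F)
    (hxkS : xk ∈ S)
    (hzk : ∀ ζ : F, conj g zk + ((-⟪zk, A xk⟫ + γ / 2 * ‖zk‖ ^ 2 : ℝ) : EReal)
        ≤ conj g ζ + ((-⟪ζ, A xk⟫ + γ / 2 * ‖ζ‖ ^ 2 : ℝ) : EReal))
    (hθpos : 0 < θk)
    (hθdef : ((θk : ℝ) : EReal) * f (K xk) = psi S g h A δ γ xk zk uk)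
    (hyk1 : yk1 ∈ subdiff f (K xk))
    (hxk1S : xk1 ∈ S)
    (hxk1 : ∀ w ∈ S,
        ⟪zk, A xk1⟫ - θk * ⟪K xk1, yk1⟫ + ⟪h' xk, xk1 - xk⟫ + δ / 2 * ‖xk1 - uk‖ ^ 2
          ≤ ⟪zk, A w⟫ - θk * ⟪K w, yk1⟫ + ⟪h' xk, w - xk⟫ + δ / 2 * ‖w - uk‖ ^ 2)
    (huk1 : uk1 = (1 - β) • uk + β • xk1)
    (hzk1 : ∀ ζ : F, conj g zk1 + ((-⟪zk1, A xk1⟫ + γ / 2 * ‖zk1‖ ^ 2 : ℝ) : EReal)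
        ≤ conj g ζ + ((-⟪ζ, A xk1⟫ + γ / 2 * ‖ζ‖ ^ 2 : ℝ) : EReal)) :
    psi S g h A δ γ xk1 zk1 uk1 - (θk : EReal) * f (K xk1)
      ≤ ((-(c₁ * ‖xk - xk1‖ ^ 2 + c₂ * ‖uk - uk1‖ ^ 2 + c₃ * ‖zk - zk1‖ ^ 2) : ℝ) : EReal) := by
  obtain ⟨-, hSconv, -, hgp, -, -, ⟨O, -, hSO, hgrad, hlip⟩, hfp, -, -, hKint, -, -, -⟩ := hA1
  obtain ⟨v, hv⟩ := hA2.1 xk hxkS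
  have hvt := conj_ne_top_of_mem_subdiff hgp hv
  obtain ⟨a, ha⟩ : ∃ a : ℝ, conj g zk = a := by
    lift conj g zk to ℝ using ⟨conj_ne_top_of_prox hgp hvt hzk, conj_ne_bot hgp zk⟩ with a
    exact ⟨a, rfl⟩
  obtain ⟨a1, ha1⟩ : ∃ a : ℝ, conj g zk1 = a := by
    lift conj g zk1 to ℝ using ⟨conj_ne_top_of_prox hgp hvt hzk1, conj_ne_bot hgp zk1⟩ with a
    exact ⟨a, rfl⟩
  have hf : ∀ x ∈ S, ∃ b : ℝ, f (K x) = b := fun x hx => by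
    have hx' : f (K x) ≠ ⊤ := interior_subset (hKint x hx)
    lift f (K x) to ℝ using ⟨hx', hfp.1 _⟩ with b
    exact ⟨b, rfl⟩
  obtain ⟨b, hb⟩ := hf xk hxkS
  obtain ⟨b1, hb1⟩ := hf xk1 hxk1S
  have hsub : b + (⟪yk1, K xk1 - K xk⟫ - 0) ≤ b1 := by
    have := hyk1.2 (K xk1)
    rw [hb, hb1] at this
    exact_mod_cast this
  have hθ : θk * b = ⟪zk, A xk⟫ + h xk + δ / 2 * ‖xk - uk‖ ^ 2 - γ / 2 * ‖zk‖ ^ 2 - a := by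
    rw [hb, psi, ha, indicatorFn, if_pos hxkS, add_zero] at hθdef
    exact_mod_cast hθdef
  have hdesc := descent_of_gradient_lipschitz hgrad hlip
    ((hSconv.segment_subset hxkS hxk1S).trans hSO)
  have hprox := quadratic_growth_of_prox_conj hgp ha ha1 hzk
  have hprox1 := quadratic_growth_of_prox_conj hgp ha1 ha hzk1
  have hp : ∀ w : E, ⟪ContinuousLinearMap.adjoint A zk - θk • ContinuousLinearMap.adjoint K yk1
      + h' xk, w⟫ = ⟪zk, A w⟫ - θk * ⟪yk1, K w⟫ + ⟪h' xk, w⟫ := fun w => by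
    rw [inner_add_left, inner_sub_left, real_inner_smul_left,
      ContinuousLinearMap.adjoint_inner_left, ContinuousLinearMap.adjoint_inner_left]
  have hx := quadratic_growth_of_linear_add_sq hSconv (δ := δ) (u := uk) hxk1S (p :=
      ContinuousLinearMap.adjoint A zk - θk • ContinuousLinearMap.adjoint K yk1 + h' xk)
    (fun w hw => by
      have := hxk1 w hw
      rw [inner_sub_right, inner_sub_right, real_inner_comm yk1 (K xk1),
        real_inner_comm yk1 (K w)] at this
      rw [hp, hp]
      linarith) hxkS
  rw [hp, hp] at hx
  rw [norm_sub_rev zk zk1, norm_sub_rev xk xk1, norm_sub_rev uk uk1]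
  rw [norm_sub_rev zk zk1] at hprox1
  rw [norm_sub_rev xk xk1] at hx
  have hcross : ⟪zk1 - zk, A (xk1 - xk)⟫ ≤ ‖A‖ ^ 2 / γ * ‖xk1 - xk‖ ^ 2 := by
    have hlow : γ * ‖zk1 - zk‖ ^ 2 ≤ ⟪zk1 - zk, A (xk1 - xk)⟫ := by
      rw [map_sub, inner_sub_left, inner_sub_right, inner_sub_right]
      linarith
    have hup : ⟪zk1 - zk, A (xk1 - xk)⟫ ≤ ‖zk1 - zk‖ * (‖A‖ * ‖xk1 - xk‖) :=
      (real_inner_le_norm _ _).trans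
        (mul_le_mul_of_nonneg_left (A.le_opNorm _) (norm_nonneg _))
    rw [div_mul_eq_mul_div, le_div_iff₀ hγ]
    nlinarith [sq_nonneg (γ * ‖zk1 - zk‖ - ‖A‖ * ‖xk1 - xk‖)]
  have hu : δ / 2 * ‖xk1 - uk1‖ ^ 2 + c₂ * ‖uk1 - uk‖ ^ 2 = δ / 2 * ‖xk1 - uk‖ ^ 2 := by
    have e1 : xk1 - uk1 = (1 - β) • (xk1 - uk) := by rw [huk1]; module
    have e2 : uk1 - uk = β • (xk1 - uk) := by rw [huk1]; module
    have hβ0 : β ≠ 0 := hβ.1.ne'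
    rw [e1, e2, norm_smul, norm_smul, mul_pow, mul_pow, Real.norm_eq_abs, Real.norm_eq_abs,
      sq_abs, sq_abs, hc₂]
    field_simp
    ring
  have hδ2 : δ / 2 * ‖xk1 - xk‖ ^ 2 = ν * ‖xk1 - xk‖ ^ 2 + Lh / 2 * ‖xk1 - xk‖ ^ 2
      + ‖A‖ ^ 2 / γ * ‖xk1 - xk‖ ^ 2 := by
    rw [hδ]; ring
  have hθsub := mul_le_mul_of_nonneg_left hsub hθpos.le
  rw [inner_sub_right] at hθsub hdesc
  rw [map_sub, inner_sub_left, inner_sub_right, inner_sub_right] at hcross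
  rw [psi, ha1, hb1, indicatorFn, if_pos hxk1S, add_zero]
  have hfinal : ⟪zk1, A xk1⟫ + h xk1 + δ / 2 * ‖xk1 - uk1‖ ^ 2 - γ / 2 * ‖zk1‖ ^ 2 - a1 - θk * b1
      ≤ -(c₁ * ‖xk1 - xk‖ ^ 2 + c₂ * ‖uk1 - uk‖ ^ 2 + c₃ * ‖zk1 - zk‖ ^ 2) := by
    rw [hc₁, hc₃]
    linarith
  exact_mod_cast hfinal

end FracPaper
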